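/- arXiv:2007.11051 — 2 statements merged into one kernel-verified Lean document; each statement's English description precedes it below -/
import Mathlib

section
/- Let G be a connected simple graph on [N] with an edge e = uv such that deg_G(u) = 2. If (c_1,…,c_N) is a D(G)-draconian sequence, then the length-(N+1) sequence obtained from c by increasing the entry c_u by 1 and appending a final entry 0 is a D(G△e)-draconian sequence. Moreover, this map is an injection from 𝔇(G) into 𝔇(G△e). -/
open Finset

attribute [local instance] Classical.propDecidable

/-- The set of neighbors of `i` in `G`, as a `Finset`. -/
noncomputable def nbr {N : ℕ} (G : SimpleGraph (Fin N)) (i : Fin N) : Finset (Fin N) :=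
  Finset.univ.filter (fun j => G.Adj i j)

/-- `(a 1, …, a N)` is a `D(G)`-draconian sequence: the entries sum to `N - 1` and for
every nonempty `S ⊆ [N]` one has `∑_{i ∈ S} a i < |S ∪ ⋃_{i ∈ S} N_G(i)|`. -/
def draconian {N : ℕ} (G : SimpleGraph (Fin N)) (a : Fin N → ℕ) : Prop :=
  (∑ i, a i) = N - 1 ∧
  ∀ S : Finset (Fin N), S.Nonempty →
    (∑ i ∈ S, a i) < (S ∪ S.biUnion (fun i => nbr G i)).card

/-- The subdivision `G : e` of the edge `e = uv` of `G`: the graph on `[N+1]` with edge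
set `(E(G) ∖ {uv}) ∪ {u(N+1), v(N+1)}`. -/
def subdiv {N : ℕ} (G : SimpleGraph (Fin N)) (u v : Fin N) : SimpleGraph (Fin (N + 1)) :=
  SimpleGraph.fromRel (fun i j =>
    (∃ a b : Fin N, i = a.castSucc ∧ j = b.castSucc ∧ G.Adj a b ∧
      ¬(a = u ∧ b = v) ∧ ¬(a = v ∧ b = u))
    ∨ (i = u.castSucc ∧ j = Fin.last N) ∨ (i = v.castSucc ∧ j = Fin.last N))

/-- The graph `G △ e` for an edge `e = uv` of `G`: the graph on `[N+1]` with edge set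
`E(G) ∪ {u(N+1), v(N+1)}`. -/
def triExt {N : ℕ} (G : SimpleGraph (Fin N)) (u v : Fin N) : SimpleGraph (Fin (N + 1)) :=
  SimpleGraph.fromRel (fun i j =>
    (∃ a b : Fin N, i = a.castSucc ∧ j = b.castSucc ∧ G.Adj a b)
    ∨ (i = u.castSucc ∧ j = Fin.last N) ∨ (i = v.castSucc ∧ j = Fin.last N))

/-- A graph on `[N]` is `2`-connected if it has at least `3` vertices, is connected, and
remains connected after deleting any single vertex. -/
def TwoConnected {N : ℕ} (G : SimpleGraph (Fin N)) : Prop :=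
  3 ≤ N ∧ G.Connected ∧
    ∀ v : Fin N, (G.comap (fun u : {w : Fin N // w ≠ v} => (u : Fin N))).Connected

theorem triExt_adj_castSucc {N : ℕ} {G : SimpleGraph (Fin N)} {u v a b : Fin N}
    (h : G.Adj a b) : (triExt G u v).Adj a.castSucc b.castSucc := by
  rw [triExt, SimpleGraph.fromRel_adj]
  exact ⟨fun hab => h.ne (Fin.castSucc_injective N hab), Or.inl (Or.inl ⟨a, b, rfl, rfl, h⟩)⟩

theorem triExt_adj_last {N : ℕ} (G : SimpleGraph (Fin N)) (u v : Fin N) :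
    (triExt G u v).Adj u.castSucc (Fin.last N) := by
  rw [triExt, SimpleGraph.fromRel_adj]
  exact ⟨Fin.castSucc_ne_last u, Or.inl (Or.inr (Or.inl ⟨rfl, rfl⟩))⟩

theorem sum_update_add_one {ι : Type*} [DecidableEq ι] (T : Finset ι) (c : ι → ℕ) (u : ι) :
    ∑ i ∈ T, Function.update c u (c u + 1) i = ∑ i ∈ T, c i + if u ∈ T then 1 else 0 := by
  rw [← Finset.sum_ite_eq' T u (fun _ => 1), ← Finset.sum_add_distrib]
  refine Finset.sum_congr rfl fun i _ => ?_
  by_cases h : i = u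
  · subst h; simp
  · simp [h]

/-- A sum of a sequence extended by `0` only sees the part of the index set in `[N]`. -/
theorem sum_snoc_zero {N : ℕ} (S : Finset (Fin (N + 1))) (f : Fin N → ℕ) :
    ∑ i ∈ S, (Fin.snoc f 0 : Fin (N + 1) → ℕ) i =
      ∑ i ∈ Finset.univ.filter (fun i : Fin N => i.castSucc ∈ S), f i := by
  rw [Finset.sum_filter, ← Finset.filter_univ_mem S, Finset.sum_filter, Fin.sum_univ_castSucc]
  simp

/-- The closed neighborhood in `G △ e` contains the one in `G`, and also the new vertex
if `u` is in the set. -/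
theorem card_closedNbr_add_le_triExt {N : ℕ} (G : SimpleGraph (Fin N)) (u v : Fin N)
    (S : Finset (Fin (N + 1))) (T : Finset (Fin N)) (hT : ∀ i ∈ T, i.castSucc ∈ S) :
    (T ∪ T.biUnion (fun i => nbr G i)).card + (if u ∈ T then 1 else 0) ≤
      (S ∪ S.biUnion (fun i => nbr (triExt G u v) i)).card := by
  have hsub : (T ∪ T.biUnion (fun i => nbr G i)).map Fin.castSuccEmb ⊆
      S ∪ S.biUnion (fun i => nbr (triExt G u v) i) := by
    intro x hx
    obtain ⟨y, hy, rfl⟩ := Finset.mem_map.mp hx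
    rcases Finset.mem_union.mp hy with hy | hy
    · exact Finset.mem_union_left _ (hT y hy)
    · obtain ⟨i, hi, hiy⟩ := Finset.mem_biUnion.mp hy
      refine Finset.mem_union_right _ (Finset.mem_biUnion.mpr ⟨i.castSucc, hT i hi, ?_⟩)
      exact Finset.mem_filter.mpr
        ⟨Finset.mem_univ _, triExt_adj_castSucc (Finset.mem_filter.mp hiy).2⟩
  rw [← Finset.card_map Fin.castSuccEmb]
  split_ifs with hu
  · have hlast : Fin.last N ∉ (T ∪ T.biUnion (fun i => nbr G i)).map Fin.castSuccEmb := by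
      intro h
      obtain ⟨y, -, hy⟩ := Finset.mem_map.mp h
      exact Fin.castSucc_ne_last y hy
    rw [← Finset.card_insert_of_notMem hlast]
    refine Finset.card_le_card (Finset.insert_subset ?_ hsub)
    exact Finset.mem_union_right _ (Finset.mem_biUnion.mpr ⟨u.castSucc, hT u hu,
      Finset.mem_filter.mpr ⟨Finset.mem_univ _, triExt_adj_last G u v⟩⟩)
  · exact Finset.card_le_card hsub

/-- Let `G` be connected on `[N]` with an edge `e = uv` such that `deg_G(u) = 2`. If `c` is
`D(G)`-draconian, then the sequence obtained from `c` by increasing `c u` by `1` and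
appending a final `0` is `D(G△e)`-draconian; moreover, this map is an injection from
`𝔇(G)` into `𝔇(G△e)`. -/
theorem draconian_update_snoc_zero_triExt {N : ℕ} (G : SimpleGraph (Fin N))
    (hconn : G.Connected) (u v : Fin N) (he : G.Adj u v) (hdeg : (nbr G u).card = 2) :
    (∀ c : Fin N → ℕ, draconian G c →
        draconian (triExt G u v) (Fin.snoc (Function.update c u (c u + 1)) 0)) ∧
    Set.InjOn
      (fun c : Fin N → ℕ =>
        (Fin.snoc (Function.update c u (c u + 1)) 0 : Fin (N + 1) → ℕ))
      {a | draconian G a} := by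
  refine ⟨fun c hc => ⟨?_, fun S hS => ?_⟩, fun a _ b _ hab => ?_⟩
  · have hN : 0 < N := u.pos
    rw [Fin.sum_univ_castSucc]
    simp only [Fin.snoc_castSucc, Fin.snoc_last, sum_update_add_one, hc.1, Finset.mem_univ, if_true]
    omega
  · rw [sum_snoc_zero, sum_update_add_one]
    set T := Finset.univ.filter (fun i : Fin N => i.castSucc ∈ S)
    rcases T.eq_empty_or_nonempty with hT | hT
    · simp [hT, hS]
    · have h := card_closedNbr_add_le_triExt G u v S T fun i hi => (Finset.mem_filter.mp hi).2
      have := hc.2 T hT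
      omega
  · have hupd := (Fin.snoc_injective2 hab).1
    funext i
    have hi := congrFun hupd i
    by_cases h : i = u
    · subst h; simpa using hi
    · simpa [h] using hi
end

section
/- For all N ≥ 3, the number of D(K_{2,N−2})-draconian sequences (which equals NVol(∇^PQ_{K_{2,N−2}})) is 2^{N−4}(N²−N+6) − 2; equivalently, in integer form valid for all N ≥ 3: 2·|𝔇(K_{2,N−2})| = 2^{N−3}(N²−N+6) − 4, where K_{2,N−2} is the complete bipartite graph on [N] with partite sets {1,2} and {3,…,N}. -/
open Finset

attribute [local instance] Classical.propDecidable

/-- The complete bipartite graph `K_{2,N-2}` on `[N]`, with partite sets `{1,2}` and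
`{3,…,N}` (here `0`-indexed: `{0,1}` and `{2,…,N-1}`). -/
def K2N (N : ℕ) : SimpleGraph (Fin N) :=
  SimpleGraph.fromRel (fun i j => (i : ℕ) < 2 ∧ 2 ≤ (j : ℕ))

theorem K2N_adj {N : ℕ} {i j : Fin N} :
    (K2N N).Adj i j ↔ ((i : ℕ) < 2 ∧ 2 ≤ (j : ℕ)) ∨ ((j : ℕ) < 2 ∧ 2 ≤ (i : ℕ)) := by
  simp only [K2N, SimpleGraph.fromRel_adj, ne_eq, Fin.ext_iff]
  omega

/-- The union of the closed neighborhoods of the vertices in `S`. -/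
noncomputable def closedNbr {N : ℕ} (G : SimpleGraph (Fin N)) (S : Finset (Fin N)) :
    Finset (Fin N) :=
  S ∪ S.biUnion (fun i => nbr G i)

theorem mem_closedNbr {N : ℕ} {G : SimpleGraph (Fin N)} {S : Finset (Fin N)} {j : Fin N} :
    j ∈ closedNbr G S ↔ j ∈ S ∨ ∃ i ∈ S, G.Adj i j := by
  simp [closedNbr, nbr]

theorem draconian_iff {N : ℕ} {G : SimpleGraph (Fin N)} {a : Fin N → ℕ} :
    draconian G a ↔ ∑ i, a i = N - 1 ∧
      ∀ S : Finset (Fin N), S.Nonempty → ∑ i ∈ S, a i < #(closedNbr G S) :=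
  Iff.rfl

/-- Subset sums exceed cardinalities by at most `e` iff the total excess over `1` is at most `e`. -/
theorem forall_sum_le_card_add_iff {ι : Type*} [Fintype ι] (b : ι → ℕ) (e : ℕ) :
    (∀ T : Finset ι, ∑ i ∈ T, b i ≤ #T + e) ↔ ∑ i, (b i - 1) ≤ e := by
  constructor
  · intro h
    have h1 := h (univ.filter fun i => b i - 1 ≠ 0)
    rw [← Finset.sum_filter_ne_zero]
    have h2 : ∑ i ∈ univ.filter (fun i => b i - 1 ≠ 0), b i
        = ∑ i ∈ univ.filter (fun i => b i - 1 ≠ 0), ((b i - 1) + 1) := by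
      refine Finset.sum_congr rfl fun i hi => ?_
      simp only [Finset.mem_filter] at hi
      omega
    rw [Finset.sum_add_distrib, Finset.sum_const, smul_eq_mul, mul_one] at h2
    omega
  · intro h T
    have h1 : ∑ i ∈ T, b i ≤ ∑ i ∈ T, ((b i - 1) + 1) :=
      Finset.sum_le_sum fun i _ => by omega
    have h2 : ∑ i ∈ T, (b i - 1) ≤ ∑ i, (b i - 1) :=
      Finset.sum_le_sum_of_subset (Finset.subset_univ T)
    rw [Finset.sum_add_distrib, Finset.sum_const, smul_eq_mul, mul_one] at h1
    omega

theorem draconian_K2N_iff {n : ℕ} (a : Fin (n + 2) → ℕ) :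
    draconian (K2N (n + 2)) a ↔
      (∑ i, a i = n + 1 ∧ ∑ j : Fin n, (a j.succ.succ - 1) ≤ 1) ∧ a 0 ≤ n ∧ a 1 ≤ n := by
  let ι : Fin n ↪ Fin (n + 2) := (Fin.succEmb n).trans (Fin.succEmb (n + 1))
  have val_ι (i : Fin n) : (ι i : ℕ) = i + 2 := rfl
  have val_lt_two {i : Fin (n + 2)} (hi : (i : ℕ) < 2) : i = 0 ∨ i = 1 := by
    simp only [Fin.ext_iff, Fin.val_zero, Fin.val_one]
    omega
  have closedNbr_singleton {i k : Fin (n + 2)} (hi : (i : ℕ) < 2) (hk : (k : ℕ) < 2)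
      (hik : i ≠ k) : closedNbr (K2N (n + 2)) {i} = univ.erase k := by
    ext j
    simp only [mem_closedNbr, Finset.mem_singleton, exists_eq_left, K2N_adj, Finset.mem_erase,
      Finset.mem_univ, and_true]
    simp only [ne_eq, Fin.ext_iff] at hik ⊢
    omega
  have closedNbr_map {T : Finset (Fin n)} (hT : T.Nonempty) :
      #(closedNbr (K2N (n + 2)) (T.map ι)) = #T + 2 := by
    have hdisj : Disjoint (T.map ι) {0, 1} := by
      rw [Finset.disjoint_left]
      intro j hj hj'
      obtain ⟨i, -, rfl⟩ := Finset.mem_map.1 hj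
      have := val_ι i
      simp only [Finset.mem_insert, Finset.mem_singleton] at hj'
      rcases hj' with h | h <;> simp [h] at this
    have hunion : closedNbr (K2N (n + 2)) (T.map ι) = (T.map ι).disjUnion {0, 1} hdisj := by
      ext j
      rw [mem_closedNbr, Finset.mem_disjUnion]
      refine or_congr_right ⟨?_, fun hj => ?_⟩
      · rintro ⟨_, hi, hij⟩
        obtain ⟨i, -, rfl⟩ := Finset.mem_map.1 hi
        rw [K2N_adj, val_ι] at hij
        simpa using val_lt_two (i := j) (by omega)
      · obtain ⟨i, hi⟩ := hT
        refine ⟨ι i, Finset.mem_map_of_mem ι hi, K2N_adj.2 ?_⟩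
        have hj' : (j : ℕ) < 2 := by
          simp only [Finset.mem_insert, Finset.mem_singleton] at hj
          rcases hj with rfl | rfl <;> simp
        exact Or.inr ⟨hj', by simp [val_ι]⟩
    rw [hunion, Finset.card_disjUnion, Finset.card_map, Finset.card_pair (by simp)]
  rw [draconian_iff]
  constructor
  · rintro ⟨hs, h⟩
    have hsmall {i k : Fin (n + 2)} (hi : (i : ℕ) < 2) (hk : (k : ℕ) < 2) (hik : i ≠ k) :
        a i ≤ n := by
      have h1 := h {i} (Finset.singleton_nonempty i)
      rw [closedNbr_singleton hi hk hik, Finset.card_erase_of_mem (Finset.mem_univ k),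
        Finset.card_univ, Fintype.card_fin, Finset.sum_singleton] at h1
      omega
    refine ⟨⟨hs, (forall_sum_le_card_add_iff _ _).1 fun T => ?_⟩,
      hsmall (k := 1) (by simp) (by simp) (by simp), hsmall (k := 0) (by simp) (by simp) (by simp)⟩
    rcases T.eq_empty_or_nonempty with rfl | hT
    · simp
    have h1 := h (T.map ι) hT.map
    rw [closedNbr_map hT, Finset.sum_map] at h1
    exact Nat.le_of_lt_succ h1
  · rintro ⟨⟨hs, hb⟩, h0, h1⟩
    refine ⟨hs, fun S hS => ?_⟩
    have huniv (h : ∀ j, j ∈ closedNbr (K2N (n + 2)) S) :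
        ∑ i ∈ S, a i < #(closedNbr (K2N (n + 2)) S) := by
      have hle : ∑ i ∈ S, a i ≤ n + 1 := hs ▸ Finset.sum_le_sum_of_subset (Finset.subset_univ S)
      rw [Finset.eq_univ_of_forall h, Finset.card_univ, Fintype.card_fin]
      omega
    have hsingle {i k : Fin (n + 2)} (hi : (i : ℕ) < 2) (hk : (k : ℕ) < 2) (hik : i ≠ k)
        (ha : a i ≤ n) : ∑ j ∈ {i}, a j < #(closedNbr (K2N (n + 2)) {i}) := by
      rw [closedNbr_singleton hi hk hik, Finset.card_erase_of_mem (Finset.mem_univ k),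
        Finset.card_univ, Fintype.card_fin, Finset.sum_singleton]
      omega
    by_cases hbig : ∃ i ∈ S, 2 ≤ (i : ℕ)
    · by_cases hsmall : ∃ k ∈ S, (k : ℕ) < 2
      · obtain ⟨i, hiS, hi⟩ := hbig
        obtain ⟨k, hkS, hk⟩ := hsmall
        refine huniv fun j => mem_closedNbr.2 (Or.inr ?_)
        rcases lt_or_ge (j : ℕ) 2 with hj | hj
        · exact ⟨i, hiS, K2N_adj.2 (by omega)⟩
        · exact ⟨k, hkS, K2N_adj.2 (by omega)⟩
      · push Not at hsmall
        have hmap : S ⊆ univ.map ι := fun i hi => by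
          have := hsmall i hi
          exact Finset.mem_map.2 ⟨⟨i - 2, by omega⟩, Finset.mem_univ _, Fin.ext (by
            rw [val_ι]
            exact Nat.sub_add_cancel this)⟩
        obtain ⟨T, -, rfl⟩ := Finset.subset_map_iff.1 hmap
        rw [closedNbr_map (Finset.map_nonempty.1 hS), Finset.sum_map]
        exact Nat.lt_succ_of_le ((forall_sum_le_card_add_iff _ _).2 hb T)
    · push Not at hbig
      have hpair : S ⊆ {0, 1} := fun i hi => by simpa using val_lt_two (hbig i hi)
      have hcases : S = ∅ ∨ S = {0} ∨ S = {1} ∨ S = {0, 1} := by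
        rw [← Finset.coe_subset, Finset.coe_pair, Set.subset_pair_iff_eq] at hpair
        exact_mod_cast hpair
      rcases hcases with rfl | rfl | rfl | rfl
      · exact absurd hS Finset.not_nonempty_empty
      · exact hsingle (k := 1) (by simp) (by simp) (by simp) h0
      · exact hsingle (k := 0) (by simp) (by simp) (by simp) h1
      · refine huniv fun j => mem_closedNbr.2 ?_
        rcases lt_or_ge (j : ℕ) 2 with hj | hj
        · exact Or.inl (by simpa using val_lt_two hj)
        · exact Or.inr ⟨0, by simp, K2N_adj.2 (by simp [hj])⟩

/-- The sum of `k - ∑ b` over the words `b` in `{0, 1, 2}` with at most `e` letters `2`. -/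
def wordWeight (n e : ℕ) (k : ℤ) : ℤ :=
  ∑ b : Fin n → Fin 3, if ∑ j, ((b j : ℕ) - 1) ≤ e then k - ∑ j, (b j : ℤ) else 0

theorem wordWeight_succ (n e : ℕ) (k : ℤ) :
    wordWeight (n + 1) e k = wordWeight n e k + wordWeight n e (k - 1) +
      if e = 0 then 0 else wordWeight n (e - 1) (k - 2) := by
  unfold wordWeight
  rw [← (Fin.consEquiv fun _ => Fin 3).sum_comp, Fintype.sum_prod_type, Fin.sum_univ_three]
  simp only [Fin.consEquiv_apply, Fin.sum_univ_succ, Fin.cons_zero, Fin.cons_succ]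
  congr 1
  · congr 1
    · simp
    · simp [sub_sub]
  · rcases e with _ | e
    · simp
    · simp [sub_sub, add_comm 1]

theorem two_mul_wordWeight_zero (n : ℕ) (k : ℤ) :
    2 * wordWeight n 0 k = 2 ^ n * (2 * k - n) := by
  induction n generalizing k with
  | zero => simp [wordWeight]
  | succ n ih =>
    rw [wordWeight_succ, if_pos rfl, add_zero, mul_add, ih, ih]
    push_cast
    ring

theorem four_mul_wordWeight_one (n : ℕ) (k : ℤ) :
    4 * wordWeight n 1 k = 2 ^ n * (4 * k - 2 * n + 2 * n * (k - 2) - n * (n - 1)) := by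
  induction n generalizing k with
  | zero => simp [wordWeight]
  | succ n ih =>
    have h := two_mul_wordWeight_zero n (k - 2)
    rw [wordWeight_succ, if_neg one_ne_zero, mul_add, mul_add, ih, ih]
    push_cast
    linear_combination 2 * h

theorem ncard_excess_le_one (n : ℕ) :
    ({a : Fin (n + 2) → ℕ | ∑ i, a i = n + 1 ∧ ∑ j : Fin n, (a j.succ.succ - 1) ≤ 1}.ncard : ℤ)
      = wordWeight n 1 (n + 2) := by
  have hle (b : Fin n → ℕ) (hb : ∑ j, (b j - 1) ≤ 1) : ∑ j, b j ≤ n + 1 := by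
    simpa using (forall_sum_le_card_add_iff b 1).2 hb univ
  let W : Finset (Fin n → Fin 3) := univ.filter fun b => ∑ j, ((b j : ℕ) - 1) ≤ 1
  let P := W.sigma fun b => Finset.range (n + 2 - ∑ j, (b j : ℕ))
  let f : (Σ _ : Fin n → Fin 3, ℕ) → Fin (n + 2) → ℕ := fun p =>
    Fin.cons p.2 (Fin.cons (n + 1 - ∑ j, (p.1 j : ℕ) - p.2) fun j => (p.1 j : ℕ))
  have himage : {a : Fin (n + 2) → ℕ |
      ∑ i, a i = n + 1 ∧ ∑ j : Fin n, (a j.succ.succ - 1) ≤ 1} = f '' P := by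
    ext a
    simp only [Set.mem_ofPred_eq, Set.mem_image, SetLike.mem_coe]
    constructor
    · rintro ⟨hs, he⟩
      have hlt (j : Fin n) : a j.succ.succ < 3 := by
        have := (Finset.single_le_sum (f := fun j : Fin n => a j.succ.succ - 1)
          (fun _ _ => Nat.zero_le _) (Finset.mem_univ j)).trans he
        omega
      have hs' := hs
      rw [Fin.sum_univ_succ, Fin.sum_univ_succ] at hs'
      refine ⟨⟨fun j => ⟨a j.succ.succ, hlt j⟩, a 0⟩, ?_, ?_⟩
      · simp only [P, W, Finset.mem_sigma, Finset.mem_filter, Finset.mem_univ, true_and,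
          Finset.mem_range]
        exact ⟨he, by omega⟩
      · funext i
        refine Fin.cases ?_ (Fin.cases ?_ fun j => ?_) i
        · rfl
        · simp only [f, Fin.cons_succ, Fin.cons_zero]
          omega
        · rfl
    · rintro ⟨⟨b, x⟩, hp, rfl⟩
      simp only [P, W, Finset.mem_sigma, Finset.mem_filter, Finset.mem_univ, true_and,
        Finset.mem_range] at hp
      simp only [f, Fin.sum_univ_succ, Fin.cons_succ, Fin.cons_zero]
      exact ⟨by omega, hp.1⟩
  have hinj : Function.Injective f := by
    rintro ⟨b, x⟩ ⟨c, y⟩ h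
    have hx : x = y := congrFun h 0
    have hb : b = c := funext fun j => Fin.ext (congrFun h j.succ.succ)
    rw [hx, hb]
  rw [himage, Set.ncard_image_of_injective _ hinj, Set.ncard_coe_finset, Finset.card_sigma,
    wordWeight, ← Finset.sum_filter]
  push_cast
  refine Finset.sum_congr rfl fun b hb => ?_
  have := hle (fun j => b j) (Finset.mem_filter.1 hb).2
  rw [Finset.card_range, Nat.cast_sub (by omega)]
  push_cast
  ring

theorem ncard_draconian_K2N_add_two (n : ℕ) :
    {a : Fin (n + 2) → ℕ | draconian (K2N (n + 2)) a}.ncard + 2 =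
    {a : Fin (n + 2) → ℕ | ∑ i, a i = n + 1 ∧ ∑ j : Fin n, (a j.succ.succ - 1) ≤ 1}.ncard := by
  set E := {a : Fin (n + 2) → ℕ | ∑ i, a i = n + 1 ∧ ∑ j : Fin n, (a j.succ.succ - 1) ≤ 1}
  let u : Fin (n + 2) → ℕ := Pi.single 0 (n + 1)
  let v : Fin (n + 2) → ℕ := Pi.single 1 (n + 1)
  have huv : u ≠ v := fun h => by simpa [u, v] using congrFun h 0
  have h_eq_single {a : Fin (n + 2) → ℕ} (k : Fin (n + 2)) (hs : ∑ i, a i = n + 1) (hk : n < a k) :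
      a = Pi.single k (n + 1) := by
    rw [← Finset.add_sum_erase _ _ (Finset.mem_univ k)] at hs
    have h0 : ∑ i ∈ univ.erase k, a i = 0 := by omega
    funext i
    rcases eq_or_ne i k with rfl | hik
    · rw [Pi.single_eq_same]
      omega
    · rw [Pi.single_eq_of_ne hik]
      exact Finset.sum_eq_zero_iff.1 h0 i (by simp [hik])
  have hsub : ({u, v} : Set (Fin (n + 2) → ℕ)) ⊆ E := by
    rintro a (rfl | rfl)
    · simp [E, u]
    · refine ⟨by simp [v], ?_⟩
      simp [v, Fin.ext_iff]
  have hdiff : {a : Fin (n + 2) → ℕ | draconian (K2N (n + 2)) a} = E \ {u, v} := by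
    ext a
    simp only [Set.mem_ofPred_eq, draconian_K2N_iff, Set.mem_sdiff, Set.mem_insert_iff,
      Set.mem_singleton_iff, not_or, E]
    refine and_congr_right fun ha => and_congr ?_ ?_
    · refine ⟨?_, fun h => not_lt.1 fun hk => h (h_eq_single 0 ha.1 hk)⟩
      rintro h rfl
      simp [u] at h
    · refine ⟨?_, fun h => not_lt.1 fun hk => h (h_eq_single 1 ha.1 hk)⟩
      rintro h rfl
      simp [v] at h
  have hfin : E.Finite := by
    refine (Set.finite_Iic fun _ : Fin (n + 2) => n + 1).subset fun a ha i => ?_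
    exact ha.1 ▸ Finset.single_le_sum (fun _ _ => Nat.zero_le _) (Finset.mem_univ i)
  have hcard := Set.ncard_sdiff_add_ncard_of_subset hsub hfin
  rwa [Set.ncard_pair huv, ← hdiff] at hcard

/-- For all `N ≥ 3`, `NVol(∇^PQ_{K_{2,N-2}}) = |𝔇(K_{2,N-2})| = 2^{N-4}(N²-N+6) - 2`,
stated in the integer form `2 * |𝔇(K_{2,N-2})| = 2^{N-3}(N²-N+6) - 4` valid for all `N ≥ 3`. -/
theorem ncard_draconian_K2N {N : ℕ} (hN : 3 ≤ N) :
    2 * {a : Fin N → ℕ | draconian (K2N N) a}.ncard = 2 ^ (N - 3) * (N ^ 2 - N + 6) - 4 := by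
  obtain ⟨m, rfl⟩ := Nat.exists_eq_add_of_le' hN
  have h1 := ncard_draconian_K2N_add_two (m + 1)
  have h2 := ncard_excess_le_one (m + 1)
  have h3 := four_mul_wordWeight_one (m + 1) ((m + 1 : ℕ) + 2)
  rw [← h2, ← h1] at h3
  have h4 : (m + 3) ^ 2 - (m + 3) + 6 = m ^ 2 + 5 * m + 12 := by
    have : (m + 3) ^ 2 = m ^ 2 + 5 * m + 6 + (m + 3) := by ring
    omega
  rw [h4, Nat.add_sub_cancel]
  refine Nat.eq_sub_of_add_eq ?_
  zify
  push_cast at h3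
  refine mul_left_cancel₀ (two_ne_zero' ℤ) ?_
  linear_combination h3
end
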